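/- arXiv:1001.3308 — 4 statements merged into one kernel-verified Lean document; each statement's English description precedes it below -/
import Mathlib

section
/- Let C = (c_{kj}) be a symmetric positive definite real N×N matrix with unit diagonal (a correlation matrix). For any ω_k > 0, any d_k ∈ ℝ and any w_k ∈ {−1, 1} (k = 1, …, N), letting W be the N×N diagonal matrix with diagonal entries w_1, …, w_N, the following identity holds: (2πi)^{−N} ∫_{Im ξ_N = −w_N ω_N} ⋯ ∫_{Im ξ_1 = −w_1 ω_1} exp(Σ_{k=1}^N i ξ_k d_k − (1/2) Σ_{k,j=1}^N c_{kj} ξ_k ξ_j) · (ξ_1 ⋯ ξ_N)^{−1} dξ_1 ⋯ dξ_N = (∏_{k=1}^N w_k) · N_N((w_1 d_1, …, w_N d_N); W C W). (The integral is absolutely convergent.) -/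
open MeasureTheory Real Complex Matrix

/-- `multinormalCDF b Σ` is the probability that a centered Gaussian vector with
(symmetric positive definite) covariance matrix `Σ` satisfies `y k ≤ b k` for all `k`,
expressed via the Gaussian density. -/
noncomputable def multinormalCDF {N : ℕ} (b : Fin N → ℝ) (S : Matrix (Fin N) (Fin N) ℝ) : ℝ :=
  ∫ y in {y : Fin N → ℝ | ∀ k, y k ≤ b k},
    Real.sqrt (((2 * Real.pi) ^ N * S.det)⁻¹) * Real.exp (-(y ⬝ᵥ S⁻¹.mulVec y) / 2)

section Helpers

variable {N : ℕ}

lemma measurableEmbedding_mulVec {M : Matrix (Fin N) (Fin N) ℝ} (hM : M.det ≠ 0) :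
    MeasurableEmbedding (Matrix.toLin' M) := by
  have hdet : LinearMap.det (Matrix.toLin' M) ≠ 0 := by rwa [LinearMap.det_toLin']
  exact (LinearMap.equivOfDetNeZero _ hdet).toContinuousLinearEquiv.toHomeomorph.measurableEmbedding

lemma integrable_comp_mulVec_iff {M : Matrix (Fin N) (Fin N) ℝ} (hM : M.det ≠ 0)
    (g : (Fin N → ℝ) → ℂ) : Integrable (fun u => g (M *ᵥ u)) ↔ Integrable g := by
  have h := (measurableEmbedding_mulVec hM).integrable_map_iff (μ := volume) (g := g)
  rw [Real.map_matrix_volume_pi_eq_smul_volume_pi hM, integrable_smul_measure] at h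
  · exact h.symm
  · simpa using hM
  · simp

lemma integral_comp_mulVec {M : Matrix (Fin N) (Fin N) ℝ} (hM : M.det ≠ 0)
    (g : (Fin N → ℝ) → ℂ) : ∫ u, g (M *ᵥ u) = ((|M.det|⁻¹ : ℝ) : ℂ) * ∫ u, g u := by
  have h := (measurableEmbedding_mulVec hM).integral_map (μ := volume) g
  rw [Real.map_matrix_volume_pi_eq_smul_volume_pi hM, integral_smul_measure,
    ENNReal.toReal_ofReal (abs_nonneg _), abs_inv] at h
  simpa [Matrix.toLin'_apply] using h.symm

open scoped MatrixOrder ComplexOrder in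
lemma Matrix.PosSemidef.exists_eq_conjTranspose_mul_self {n 𝕜 : Type*} [Fintype n] [RCLike 𝕜]
    {S : Matrix n n 𝕜} (hS : S.PosSemidef) : ∃ B : Matrix n n 𝕜, S = Bᴴ * B := by
  classical
  exact CStarAlgebra.nonneg_iff_eq_star_mul_self.mp hS.nonneg

lemma Matrix.PosDef.exists_eq_transpose_mul_self {S : Matrix (Fin N) (Fin N) ℝ} (hS : S.PosDef) :
    ∃ B : Matrix (Fin N) (Fin N) ℝ, B.det ≠ 0 ∧ S = Bᵀ * B := by
  obtain ⟨B, hB⟩ := Matrix.PosSemidef.exists_eq_conjTranspose_mul_self hS.posSemidef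
  rw [Matrix.conjTranspose_eq_transpose_of_trivial] at hB
  refine ⟨B, fun h => hS.det_pos.ne' ?_, hB⟩
  rw [hB, Matrix.det_mul, h, mul_zero]

lemma gaussian_exponent_eq (B : Matrix (Fin N) (Fin N) ℝ) (hB : B.det ≠ 0) (z u : Fin N → ℝ) :
    (↑(-(u ⬝ᵥ (Bᵀ * B) *ᵥ u) / 2) + I * ↑(u ⬝ᵥ z) : ℂ)
      = -(1 / 2) * ∑ i, ((B *ᵥ u) i : ℂ) ^ 2
        + ∑ i, (I * ↑((B⁻¹ᵀ *ᵥ z) i)) * ↑((B *ᵥ u) i) := by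
  have h1 : u ⬝ᵥ (Bᵀ * B) *ᵥ u = ∑ i, (B *ᵥ u) i ^ 2 := by
    rw [← Matrix.mulVec_mulVec, Matrix.dotProduct_mulVec, Matrix.vecMul_transpose, dotProduct]
    simp [sq]
  have h2 : u ⬝ᵥ z = ∑ i, (B⁻¹ᵀ *ᵥ z) i * (B *ᵥ u) i := by
    change _ = (B⁻¹ᵀ *ᵥ z) ⬝ᵥ (B *ᵥ u)
    rw [Matrix.dotProduct_mulVec, Matrix.mulVec_transpose, Matrix.vecMul_vecMul,
      Matrix.nonsing_inv_mul _ (isUnit_iff_ne_zero.mpr hB), Matrix.vecMul_one, dotProduct_comm]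
  rw [h1, h2]
  push_cast
  simp only [Finset.mul_sum, mul_assoc]
  congr 1
  rw [← Finset.mul_sum]
  ring

lemma integrable_cexp_gaussian {S : Matrix (Fin N) (Fin N) ℝ} (hS : S.PosDef) (z : Fin N → ℝ) :
    Integrable fun u : Fin N → ℝ => cexp (↑(-(u ⬝ᵥ S *ᵥ u) / 2) + I * ↑(u ⬝ᵥ z)) := by
  obtain ⟨B, hB, rfl⟩ := hS.exists_eq_transpose_mul_self
  simp_rw [gaussian_exponent_eq B hB]
  exact (integrable_comp_mulVec_iff hB fun v => cexp (-(1 / 2) * ∑ i, (v i : ℂ) ^ 2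
    + ∑ i, (I * ↑((B⁻¹ᵀ *ᵥ z) i)) * ↑(v i))).mpr
    (GaussianFourier.integrable_cexp_neg_mul_sum_add (by norm_num) _)

lemma integral_cexp_gaussian {S : Matrix (Fin N) (Fin N) ℝ} (hS : S.PosDef) (z : Fin N → ℝ) :
    ∫ u : Fin N → ℝ, cexp (↑(-(u ⬝ᵥ S *ᵥ u) / 2) + I * ↑(u ⬝ᵥ z))
      = ((√((2 * π) ^ N / S.det) * rexp (-(z ⬝ᵥ S⁻¹ *ᵥ z) / 2) : ℝ) : ℂ) := by
  obtain ⟨B, hB, rfl⟩ := hS.exists_eq_transpose_mul_self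
  simp_rw [gaussian_exponent_eq B hB]
  rw [integral_comp_mulVec hB fun v => cexp (-(1 / 2) * ∑ i, (v i : ℂ) ^ 2
    + ∑ i, (I * ↑((B⁻¹ᵀ *ᵥ z) i)) * ↑(v i)),
    GaussianFourier.integral_cexp_neg_mul_sum_add (by norm_num)]
  have h1 : z ⬝ᵥ (Bᵀ * B)⁻¹ *ᵥ z = ∑ i, (B⁻¹ᵀ *ᵥ z) i ^ 2 := by
    rw [Matrix.mul_inv_rev, ← Matrix.mulVec_mulVec, Matrix.dotProduct_mulVec,
      ← Matrix.transpose_nonsing_inv, ← Matrix.mulVec_transpose, dotProduct]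
    simp [sq]
  have h2 : √((2 * π) ^ N / (Bᵀ * B).det) = |B.det|⁻¹ * √((2 * π) ^ N) := by
    rw [Matrix.det_mul, Matrix.det_transpose, Real.sqrt_div (by positivity),
      Real.sqrt_mul_self_eq_abs]
    ring
  have h3 : ((π : ℂ) / (1 / 2)) ^ ((Fintype.card (Fin N) : ℂ) / 2) = ((√((2 * π) ^ N) : ℝ) : ℂ) := by
    rw [Real.sqrt_eq_rpow, ← Real.rpow_natCast, ← Real.rpow_mul (by positivity),
      Complex.ofReal_cpow (by positivity), Fintype.card_fin]
    push_cast
    congr 1 <;> ring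
  rw [h1, h2, h3]
  push_cast
  simp only [mul_pow, I_sq, neg_one_mul, Finset.sum_neg_distrib]
  rw [mul_assoc]
  congr 3
  ring

/-- Expansion of the exponent along the shifted contour into its real and imaginary parts. -/
lemma contour_exponent_eq {S : Matrix (Fin N) (Fin N) ℝ} (hS : S.IsSymm) (ω b s u : Fin N → ℝ) :
    (∑ k, I * (↑(u k) - ↑(ω k) * I) * ↑(b k))
        - (1 / 2) * ∑ k, ∑ j, (S k j : ℂ) * (↑(u k) - ↑(ω k) * I) * (↑(u j) - ↑(ω j) * I)
        - ∑ k, I * (↑(u k) - ↑(ω k) * I) * ↑(s k)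
      = ↑(-(u ⬝ᵥ S *ᵥ u) / 2) + I * ↑(u ⬝ᵥ (b - s + S *ᵥ ω))
        + ↑(ω ⬝ᵥ (b - s) + ω ⬝ᵥ S *ᵥ ω / 2) := by
  have hsym : ∑ k, ∑ j, (S k j : ℂ) * ω k * u j = ∑ k, ∑ j, (S k j : ℂ) * u k * ω j := by
    rw [Finset.sum_comm]
    refine Finset.sum_congr rfl fun k _ => Finset.sum_congr rfl fun j _ => ?_
    rw [hS.apply]; ring
  have hquad : ∑ k, ∑ j, (S k j : ℂ) * (↑(u k) - ↑(ω k) * I) * (↑(u j) - ↑(ω j) * I)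
      = ∑ k, ∑ j, (S k j : ℂ) * u k * u j - 2 * I * ∑ k, ∑ j, (S k j : ℂ) * u k * ω j
        - ∑ k, ∑ j, (S k j : ℂ) * ω k * ω j := by
    have : 2 * I * ∑ k, ∑ j, (S k j : ℂ) * u k * ω j
        = I * ∑ k, ∑ j, (S k j : ℂ) * ω k * u j + I * ∑ k, ∑ j, (S k j : ℂ) * u k * ω j := by
      rw [hsym]; ring
    rw [this]
    simp only [Finset.mul_sum, ← Finset.sum_add_distrib, ← Finset.sum_sub_distrib]
    refine Finset.sum_congr rfl fun k _ => Finset.sum_congr rfl fun j _ => ?_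
    linear_combination (S k j : ℂ) * ω k * ω j * I_sq
  have hq (x y : Fin N → ℝ) : ((x ⬝ᵥ S *ᵥ y : ℝ) : ℂ) = ∑ k, ∑ j, (S k j : ℂ) * x k * y j := by
    simp only [dotProduct, Matrix.mulVec, Finset.mul_sum]
    push_cast
    refine Finset.sum_congr rfl fun k _ => Finset.sum_congr rfl fun j _ => ?_
    ring
  have hl : (∑ k, I * (↑(u k) - ↑(ω k) * I) * ↑(b k)) - ∑ k, I * (↑(u k) - ↑(ω k) * I) * ↑(s k)
      = I * ↑(u ⬝ᵥ (b - s)) + ↑(ω ⬝ᵥ (b - s)) := by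
    simp only [dotProduct, Pi.sub_apply]
    push_cast
    rw [Finset.mul_sum, ← Finset.sum_add_distrib, ← Finset.sum_sub_distrib]
    refine Finset.sum_congr rfl fun k _ => ?_
    linear_combination -(ω k : ℂ) * (b k - s k) * I_sq
  rw [sub_right_comm, hl, hquad, dotProduct_add]
  push_cast
  rw [hq, hq, hq]
  ring

lemma integrable_exp_neg_dotProduct_orthant {ω : Fin N → ℝ} (hω : ∀ k, 0 < ω k) :
    Integrable (fun s : Fin N → ℝ => rexp (-(ω ⬝ᵥ s)))
      (volume.restrict (Set.univ.pi fun _ => Set.Ioi 0)) := by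
  rw [volume_pi, Measure.restrict_pi_pi]
  simp_rw [dotProduct, ← Finset.sum_neg_distrib, Real.exp_sum]
  refine Integrable.fintype_prod (f := fun k (x : ℝ) => rexp (-(ω k * x))) fun k => ?_
  simpa [IntegrableOn] using integrableOn_exp_mul_Ioi (neg_lt_zero.mpr (hω k)) 0

lemma integral_cexp_neg_sum_orthant {ω : Fin N → ℝ} (hω : ∀ k, 0 < ω k) (u : Fin N → ℝ) :
    ∫ s in Set.univ.pi fun _ : Fin N => Set.Ioi (0 : ℝ),
        cexp (-∑ k, I * (↑(u k) - ↑(ω k) * I) * ↑(s k))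
      = (I ^ N)⁻¹ * (∏ k, ((u k : ℂ) - ↑(ω k) * I))⁻¹ := by
  rw [volume_pi, Measure.restrict_pi_pi]
  simp_rw [← Finset.sum_neg_distrib, Complex.exp_sum]
  rw [integral_fintype_prod_eq_prod
    (f := fun k (x : ℝ) => cexp (-(I * (↑(u k) - ↑(ω k) * I) * ↑x)))]
  have h (k : Fin N) : ∫ x in Set.Ioi (0 : ℝ), cexp (-(I * (↑(u k) - ↑(ω k) * I) * ↑x))
      = I⁻¹ * ((u k : ℂ) - ↑(ω k) * I)⁻¹ := by
    have := integral_exp_mul_complex_Ioi (a := -(I * (↑(u k) - ↑(ω k) * I)))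
      (by simpa using hω k) 0
    simp only [neg_mul, ofReal_zero, mul_zero, Complex.exp_zero] at this
    rw [this, neg_div_neg_eq, one_div, mul_inv]
  simp_rw [h]
  rw [Finset.prod_mul_distrib, Finset.prod_const, Finset.card_fin, inv_pow,
    Finset.prod_inv_distrib]

/-- Completing the square: the Gaussian on the shifted contour does not depend on the shift. -/
lemma completed_square_eq {S : Matrix (Fin N) (Fin N) ℝ} (hS : S.PosDef) (ω x : Fin N → ℝ) :
    -((x + S *ᵥ ω) ⬝ᵥ S⁻¹ *ᵥ (x + S *ᵥ ω)) / 2 + (ω ⬝ᵥ x + ω ⬝ᵥ S *ᵥ ω / 2)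
      = -(x ⬝ᵥ S⁻¹ *ᵥ x) / 2 := by
  have hdet : IsUnit S.det := hS.det_pos.ne'.isUnit
  have hsymm : Sᵀ = S := by
    simpa [Matrix.conjTranspose_eq_transpose_of_trivial] using hS.isHermitian.eq
  have h1 : S⁻¹ *ᵥ (S *ᵥ ω) = ω := by
    rw [Matrix.mulVec_mulVec, Matrix.nonsing_inv_mul _ hdet, Matrix.one_mulVec]
  have h2 : (S *ᵥ ω) ⬝ᵥ S⁻¹ *ᵥ x = ω ⬝ᵥ x := by
    nth_rw 1 [← hsymm]
    rw [Matrix.mulVec_transpose, ← Matrix.dotProduct_mulVec, Matrix.mulVec_mulVec,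
      Matrix.mul_nonsing_inv _ hdet, Matrix.one_mulVec]
  rw [Matrix.mulVec_add, h1, dotProduct_add, add_dotProduct, add_dotProduct, h2,
    dotProduct_comm x ω, dotProduct_comm (S *ᵥ ω) ω]
  ring

lemma setIntegral_orthant_comp_sub_left (b : Fin N → ℝ) (h : (Fin N → ℝ) → ℝ) :
    ∫ s in Set.univ.pi fun _ : Fin N => Set.Ioi (0 : ℝ), h (b - s)
      = ∫ y in {y : Fin N → ℝ | ∀ k, y k ≤ b k}, h y := by
  have hset : {y : Fin N → ℝ | ∀ k, y k ≤ b k} = Set.univ.pi fun k => Set.Iic (b k) := by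
    ext; simp [Pi.le_def]
  have hae : (Set.univ.pi fun k => Set.Iio (b k) : Set (Fin N → ℝ))
      =ᵐ[volume] Set.univ.pi fun k => Set.Iic (b k) := Measure.pi_Iio_ae_eq_pi_Iic
  rw [hset, ← setIntegral_congr_set hae,
    ← integral_indicator (MeasurableSet.univ_pi fun _ => measurableSet_Ioi),
    ← integral_indicator (MeasurableSet.univ_pi fun _ => measurableSet_Iio),
    ← integral_sub_left_eq_self _ volume b]
  congr 1 with s
  simp only [Set.indicator, Set.mem_univ_pi, Set.mem_Ioi, Set.mem_Iio, Pi.sub_apply, sub_pos,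
    sub_sub_cancel]

lemma contour_integral_eq_multinormalCDF {S : Matrix (Fin N) (Fin N) ℝ} (hS : S.PosDef)
    {ω : Fin N → ℝ} (hω : ∀ k, 0 < ω k) (b : Fin N → ℝ) :
    Integrable (fun u : Fin N → ℝ =>
      cexp ((∑ k, I * (↑(u k) - ↑(ω k) * I) * ↑(b k))
          - (1 / 2) * ∑ k, ∑ j, (S k j : ℂ) * (↑(u k) - ↑(ω k) * I) * (↑(u j) - ↑(ω j) * I))
        / ∏ k, (↑(u k) - ↑(ω k) * I)) ∧
    ((2 * π * I) ^ N)⁻¹ * ∫ u : Fin N → ℝ,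
      cexp ((∑ k, I * (↑(u k) - ↑(ω k) * I) * ↑(b k))
          - (1 / 2) * ∑ k, ∑ j, (S k j : ℂ) * (↑(u k) - ↑(ω k) * I) * (↑(u j) - ↑(ω j) * I))
        / ∏ k, (↑(u k) - ↑(ω k) * I)
      = ↑(multinormalCDF b S) := by
  have hsymm : S.IsSymm := by
    simpa [Matrix.IsSymm, Matrix.conjTranspose_eq_transpose_of_trivial] using hS.isHermitian.eq
  set ν : Measure (Fin N → ℝ) := volume.restrict (Set.univ.pi fun _ => Set.Ioi 0) with hν
  set G : (Fin N → ℝ) → (Fin N → ℝ) → ℂ := fun u s =>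
    cexp (↑(-(u ⬝ᵥ S *ᵥ u) / 2) + I * ↑(u ⬝ᵥ (b - s + S *ᵥ ω))
        + ↑(ω ⬝ᵥ (b - s) + ω ⬝ᵥ S *ᵥ ω / 2)) with hG
  have hE (u : Fin N → ℝ) :
      cexp ((∑ k, I * (↑(u k) - ↑(ω k) * I) * ↑(b k))
          - (1 / 2) * ∑ k, ∑ j, (S k j : ℂ) * (↑(u k) - ↑(ω k) * I) * (↑(u j) - ↑(ω j) * I))
        / ∏ k, (↑(u k) - ↑(ω k) * I) = I ^ N * ∫ s, G u s ∂ν := by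
    simp_rw [hG, ← contour_exponent_eq hsymm, sub_eq_add_neg (_ - _ : ℂ) (∑ k, _), Complex.exp_add]
    rw [integral_const_mul, hν, integral_cexp_neg_sum_orthant hω]
    field_simp
  have hGint : Integrable (Function.uncurry G) (volume.prod ν) := by
    have h1 := (integrable_cexp_gaussian hS 0).norm
    have h2 := (integrable_exp_neg_dotProduct_orthant hω).const_mul
      (rexp (ω ⬝ᵥ b + ω ⬝ᵥ S *ᵥ ω / 2))
    refine (h1.mul_prod h2).mono' ?_ (.of_forall fun p => le_of_eq ?_)
    · refine Continuous.aestronglyMeasurable ?_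
      simp only [hG, Function.uncurry_def, dotProduct, Matrix.mulVec]
      fun_prop
    · simp only [hG, Function.uncurry_def, Complex.norm_exp, ← Real.exp_add]
      simp [dotProduct_sub]
      ring
  simp_rw [hE]
  refine ⟨hGint.integral_prod_left.const_mul _, ?_⟩
  have hinner (s : Fin N → ℝ) : ∫ u, G u s
      = ((√((2 * π) ^ N / S.det) * rexp (-((b - s) ⬝ᵥ S⁻¹ *ᵥ (b - s)) / 2) : ℝ) : ℂ) := by
    simp_rw [hG, Complex.exp_add (_ + _)]
    rw [integral_mul_const, integral_cexp_gaussian hS, ← Complex.ofReal_exp, ← Complex.ofReal_mul,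
      mul_assoc, ← Real.exp_add, completed_square_eq hS]
  rw [integral_const_mul, integral_integral_swap hGint]
  simp_rw [hinner]
  rw [integral_complex_ofReal, hν, setIntegral_orthant_comp_sub_left b
    fun y => √((2 * π) ^ N / S.det) * rexp (-(y ⬝ᵥ S⁻¹ *ᵥ y) / 2), multinormalCDF,
    integral_const_mul, integral_const_mul]
  have hc : √(((2 * π) ^ N * S.det)⁻¹) = ((2 * π) ^ N)⁻¹ * √((2 * π) ^ N / S.det) := by
    rw [Real.sqrt_eq_iff_mul_self_eq (by have := hS.det_pos; positivity) (by positivity),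
      mul_mul_mul_comm, Real.mul_self_sqrt (by have := hS.det_pos; positivity)]
    field_simp
  rw [hc, mul_pow]
  push_cast
  field_simp

end Helpers

/-- Lemma 1: the `N`-fold contour-integral representation of the multinormal
cumulative distribution function. -/
theorem stmt0 {N : ℕ} (C : Matrix (Fin N) (Fin N) ℝ)
    (hCsymm : C.IsSymm) (hCpd : C.PosDef) (hCdiag : ∀ k, C k k = 1)
    (ω d w : Fin N → ℝ) (hω : ∀ k, 0 < ω k) (hw : ∀ k, w k = 1 ∨ w k = -1) :
    Integrable (fun u : Fin N → ℝ =>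
      Complex.exp ((∑ k, Complex.I * (↑(u k) - ↑(w k * ω k) * Complex.I) * ↑(d k))
          - (1 / 2) * ∑ k, ∑ j, (C k j : ℂ) * (↑(u k) - ↑(w k * ω k) * Complex.I)
              * (↑(u j) - ↑(w j * ω j) * Complex.I))
        / ∏ k, (↑(u k) - ↑(w k * ω k) * Complex.I)) ∧
    ((2 * Real.pi * Complex.I) ^ N)⁻¹ *
      (∫ u : Fin N → ℝ,
        Complex.exp ((∑ k, Complex.I * (↑(u k) - ↑(w k * ω k) * Complex.I) * ↑(d k))
            - (1 / 2) * ∑ k, ∑ j, (C k j : ℂ) * (↑(u k) - ↑(w k * ω k) * Complex.I)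
                * (↑(u j) - ↑(w j * ω j) * Complex.I))
          / ∏ k, (↑(u k) - ↑(w k * ω k) * Complex.I))
      = (∏ k, (w k : ℂ)) *
          ↑(multinormalCDF (fun k => w k * d k)
              (Matrix.diagonal w * C * Matrix.diagonal w)) := by
  have hw2 (k : Fin N) : (w k : ℂ) * w k = 1 := by
    rcases hw k with h | h <;> simp [h]
  have hprod : (∏ k, (w k : ℂ)) * ∏ k, (w k : ℂ) = 1 := by
    rw [← Finset.prod_mul_distrib, Finset.prod_congr rfl fun k _ => hw2 k, Finset.prod_const_one]
  have habs : |(Matrix.diagonal w).det| = 1 := by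
    rw [Matrix.det_diagonal, Finset.abs_prod]
    refine Finset.prod_eq_one fun k _ => ?_
    rcases hw k with h | h <;> simp [h]
  have hdet : (Matrix.diagonal w).det ≠ 0 := fun h => by simp [h] at habs
  have hS : (Matrix.diagonal w * C * Matrix.diagonal w).PosDef := by
    have := hCpd.conjTranspose_mul_mul_same (B := Matrix.diagonal w)
      (Matrix.mulVec_injective_iff_isUnit.mpr
        ((Matrix.isUnit_iff_isUnit_det _).mpr (isUnit_iff_ne_zero.mpr hdet)))
    simpa [Matrix.diagonal_conjTranspose] using this
  set S := Matrix.diagonal w * C * Matrix.diagonal w with hSdef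
  obtain ⟨hint, hval⟩ := contour_integral_eq_multinormalCDF hS hω fun k => w k * d k
  set F : (Fin N → ℝ) → ℂ := fun u =>
    cexp ((∑ k, I * (↑(u k) - ↑(ω k) * I) * ↑(w k * d k))
          - (1 / 2) * ∑ k, ∑ j, (S k j : ℂ) * (↑(u k) - ↑(ω k) * I) * (↑(u j) - ↑(ω j) * I))
        / ∏ k, (↑(u k) - ↑(ω k) * I) with hF
  have hcomp (u : Fin N → ℝ) :
      cexp ((∑ k, I * (↑(u k) - ↑(w k * ω k) * I) * ↑(d k))
          - (1 / 2) * ∑ k, ∑ j, (C k j : ℂ) * (↑(u k) - ↑(w k * ω k) * I)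
              * (↑(u j) - ↑(w j * ω j) * I))
        / ∏ k, (↑(u k) - ↑(w k * ω k) * I)
      = (∏ k, (w k : ℂ)) * F (Matrix.diagonal w *ᵥ u) := by
    have hx (k : Fin N) : (((Matrix.diagonal w *ᵥ u) k : ℝ) : ℂ) - ω k * I
        = w k * (u k - ↑(w k * ω k) * I) := by
      rw [Matrix.mulVec_diagonal]
      push_cast
      linear_combination ω k * I * hw2 k
    have hSkj (k j : Fin N) : (S k j : ℂ) = w k * C k j * w j := by
      simp [hSdef, Matrix.mul_diagonal, Matrix.diagonal_mul]
    have h1 : ∑ k, I * (w k * (u k - ↑(w k * ω k) * I)) * ↑(w k * d k)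
        = ∑ k, I * (↑(u k) - ↑(w k * ω k) * I) * ↑(d k) :=
      Finset.sum_congr rfl fun k _ => by
        push_cast
        linear_combination I * (↑(u k) - w k * ω k * I) * d k * hw2 k
    have h2 : ∑ k, ∑ j, (w k * C k j * w j : ℂ) * (w k * (u k - ↑(w k * ω k) * I))
          * (w j * (u j - ↑(w j * ω j) * I))
        = ∑ k, ∑ j, (C k j : ℂ) * (↑(u k) - ↑(w k * ω k) * I) * (↑(u j) - ↑(w j * ω j) * I) :=
      Finset.sum_congr rfl fun k _ => Finset.sum_congr rfl fun j _ => by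
        calc _ = (w k * w k : ℂ) * (w j * w j) * ((C k j : ℂ) * (↑(u k) - ↑(w k * ω k) * I)
              * (↑(u j) - ↑(w j * ω j) * I)) := by ring
          _ = _ := by rw [hw2, hw2, one_mul, one_mul]
    simp only [hF, hx, hSkj]
    rw [h1, h2, Finset.prod_mul_distrib, mul_div_assoc', mul_div_mul_left _ _ fun h => by
      simp [h] at hprod]
  simp_rw [hcomp]
  refine ⟨((integrable_comp_mulVec_iff hdet F).mpr hint).const_mul _, ?_⟩
  rw [integral_const_mul, integral_comp_mulVec hdet F, habs, mul_left_comm, ← hval]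
  simp
end

section
/- Let μ be a probability measure on ℝ and ω ∈ ℝ with ∫_ℝ e^{−ωx} dμ(x) < ∞. Define μ̂(ξ) = ∫_ℝ e^{iξx} dμ(x) for ξ with Im ξ = ω, and assume u ↦ μ̂(u + iω) belongs to L¹(ℝ). Let g : ℝ → ℝ be measurable with x ↦ e^{ωx} g(x) in L¹(ℝ), and define ĝ(ξ) = ∫_ℝ e^{−iξx} g(x) dx for ξ with Im ξ = ω. Then ∫_ℝ g dμ = (1/(2π)) ∫_ℝ μ̂(u + iω) ĝ(u + iω) du. -/
open MeasureTheory Real Complex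

open scoped FourierTransform

open scoped ContDiff in
/-- If a finite measure integrates smooth compactly supported functions like the continuous density
`p`, then it integrates every function like the density `p`. -/
lemma integral_eq_integral_mul_of_forall_contDiff (ν : Measure ℝ) [IsFiniteMeasure ν]
    {p : ℝ → ℂ} (hp : Continuous p)
    (h : ∀ f : ℝ → ℝ, ContDiff ℝ ∞ f → HasCompactSupport f →
      ∫ x, (f x : ℂ) ∂ν = ∫ x, (f x : ℂ) * p x) (φ : ℝ → ℂ) :
    ∫ x, φ x ∂ν = ∫ x, φ x * p x := by
  set κ : Measure ℝ := ν + volume with hκ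
  have hνκ : ν ≪ κ := Measure.absolutelyContinuous_of_le (Measure.le_add_right le_rfl)
  have hvκ : (volume : Measure ℝ) ≪ κ :=
    Measure.absolutelyContinuous_of_le (Measure.le_add_left le_rfl)
  have hq : ∀ K : Set ℝ, IsCompact K →
      IntegrableOn (fun x ↦ (ν.rnDeriv κ x).toReal • (1 : ℂ)) K κ := fun K _ ↦
    ((integrable_rnDeriv_smul_iff hνκ).2 (integrable_const _)).integrableOn
  have hr : ∀ K : Set ℝ, IsCompact K →
      IntegrableOn (fun x ↦ ((volume : Measure ℝ).rnDeriv κ x).toReal • p x) K κ := by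
    intro K hK
    have h1 : Integrable (K.indicator p) volume :=
      (integrable_indicator_iff hK.measurableSet).2 (hp.continuousOn.integrableOn_compact hK)
    rw [← integrable_indicator_iff hK.measurableSet]
    refine ((integrable_rnDeriv_smul_iff hvκ).2 h1).congr (.of_forall fun x ↦ ?_)
    by_cases hx : x ∈ K <;> simp [hx]
  have hae : ∀ᵐ x ∂κ, (ν.rnDeriv κ x).toReal • (1 : ℂ)
      - ((volume : Measure ℝ).rnDeriv κ x).toReal • p x = 0 := by
    refine ae_eq_zero_of_integral_contDiff_smul_eq_zero ?_ fun f hf hfc ↦ ?_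
    · rw [locallyIntegrable_iff]
      exact fun K hK ↦ (hq K hK).sub (hr K hK)
    · have h1 : Integrable (fun x ↦ (ν.rnDeriv κ x).toReal • (f x : ℂ)) κ :=
        (integrable_rnDeriv_smul_iff hνκ).2
          ((hf.continuous.integrable_of_hasCompactSupport hfc).ofReal)
      have h2 : Integrable
          (fun x ↦ ((volume : Measure ℝ).rnDeriv κ x).toReal • ((f x : ℂ) * p x)) κ := by
        refine (integrable_rnDeriv_smul_iff hvκ).2 ?_
        refine Continuous.integrable_of_hasCompactSupport
          ((continuous_ofReal.comp hf.continuous).mul hp) ?_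
        exact (hfc.comp_left (g := ((↑) : ℝ → ℂ)) ofReal_zero).mul_right
      have h3 := h f hf hfc
      rw [← integral_rnDeriv_smul hνκ, ← integral_rnDeriv_smul hvκ, ← sub_eq_zero,
        ← integral_sub h1 h2] at h3
      rw [← h3]
      congr with x
      simp only [real_smul]
      ring
  rw [← integral_rnDeriv_smul hνκ, ← integral_rnDeriv_smul hvκ]
  refine integral_congr_ae ?_
  filter_upwards [hae] with x hx
  simp only [real_smul, mul_one] at hx ⊢
  linear_combination φ x * hx

/-- The characteristic function of a finite measure is dual to the inverse Fourier transform. -/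
lemma integral_fourierInv_eq_integral_charFun_mul (ν : Measure ℝ) [IsFiniteMeasure ν]
    {ψ : ℝ → ℂ} (hψ : Integrable ψ) :
    ∫ x, 𝓕⁻ ψ x ∂ν = ∫ w, charFun ν (2 * π * w) * ψ w := by
  have := VectorFourier.integral_fourierIntegral_smul_eq_flip (μ := ν) (ν := volume)
    (L := -innerₗ ℝ) (e := 𝐞) (f := fun _ ↦ (1 : ℂ)) (g := ψ) Real.continuous_fourierChar
    (by simp only [LinearMap.neg_apply, innerₗ_apply_apply]; fun_prop) (integrable_const _) hψ
  simp only [smul_eq_mul] at this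
  refine Eq.trans (integral_congr_ae (.of_forall fun x ↦ ?_))
    (this.symm.trans (integral_congr_ae (.of_forall fun w ↦ ?_)))
  · simp only [Real.fourierInv_eq, VectorFourier.fourierIntegral]
    simp [mul_comm]
  · simp only [VectorFourier.fourierIntegral, charFun_apply_real]
    congr 2 with x
    simp [Circle.smul_def, Real.fourierChar_apply]
    ring_nf

/-- Parseval's identity for a finite measure with integrable characteristic function. -/
lemma integral_eq_integral_charFun_mul_fourier (ν : Measure ℝ) [IsFiniteMeasure ν]
    (hν : Integrable (charFun ν)) {φ : ℝ → ℂ} (hφ : Integrable φ) :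
    ∫ x, φ x ∂ν = ∫ w, charFun ν (2 * π * w) * 𝓕 φ w := by
  have hΦ : Integrable (fun w ↦ charFun ν (2 * π * w)) := hν.comp_mul_left' (by positivity)
  have hdual : ∀ {f : ℝ → ℂ}, Integrable f →
      ∫ w, charFun ν (2 * π * w) * 𝓕 f w = ∫ x, f x * 𝓕 (fun w ↦ charFun ν (2 * π * w)) x := by
    intro f hf
    have hflip := VectorFourier.integral_fourierIntegral_smul_eq_flip (L := innerₗ ℝ)
      Real.continuous_fourierChar (by simp only [innerₗ_apply_apply]; fun_prop) hf hΦ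
    rw [flip_innerₗ] at hflip
    simp only [smul_eq_mul] at hflip
    simp only [mul_comm (charFun ν _)]
    exact hflip
  have hcont : Continuous (𝓕 (fun w ↦ charFun ν (2 * π * w))) :=
    VectorFourier.fourierIntegral_continuous Real.continuous_fourierChar
      (by simp only [innerₗ_apply_apply]; fun_prop) hΦ
  rw [hdual hφ]
  refine integral_eq_integral_mul_of_forall_contDiff ν hcont (fun f hf hfc ↦ ?_) φ
  let s : SchwartzMap ℝ ℂ :=
    (hfc.comp_left (g := ((↑) : ℝ → ℂ)) ofReal_zero).toSchwartzMap (ofRealCLM.contDiff.comp hf)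
  have hs : ∀ x, s x = f x := fun x ↦ rfl
  simp only [← hs]
  rw [← hdual s.integrable, ← SchwartzMap.fourier_coe,
    ← integral_fourierInv_eq_integral_charFun_mul ν (𝓕 s).integrable, ← SchwartzMap.fourierInv_coe]
  simp

/-- Parseval-type identity on the line `Im ξ = ω`: the expectation `∫ g dμ` equals
`(1/(2π)) ∫ μ̂(u+iω) ĝ(u+iω) du`. -/
theorem stmt4 (μ : Measure ℝ) [IsProbabilityMeasure μ] (ω : ℝ)
    (hexp : Integrable (fun x => Real.exp (-ω * x)) μ)
    (hμhat : Integrable (fun u : ℝ =>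
      ∫ x : ℝ, Complex.exp (Complex.I * ((u : ℂ) + (ω : ℂ) * Complex.I) * x) ∂μ))
    (g : ℝ → ℝ) (hgmeas : Measurable g)
    (hgint : Integrable (fun x => Real.exp (ω * x) * g x)) :
    ((∫ x, g x ∂μ : ℝ) : ℂ)
      = (1 / (2 * Real.pi)) *
          ∫ u : ℝ,
            (∫ x : ℝ, Complex.exp (Complex.I * ((u : ℂ) + (ω : ℂ) * Complex.I) * x) ∂μ) *
            (∫ x : ℝ, Complex.exp (-Complex.I * ((u : ℂ) + (ω : ℂ) * Complex.I) * x) * (g x : ℂ)) := by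
  let ν : Measure ℝ := μ.withDensity fun x ↦ ENNReal.ofReal (Real.exp (-ω * x))
  have : IsFiniteMeasure ν := isFiniteMeasure_withDensity_ofReal hexp.2
  have hν : ∀ f : ℝ → ℂ, ∫ x, f x ∂ν = ∫ x, (Real.exp (-ω * x) : ℂ) * f x ∂μ := by
    intro f
    rw [integral_withDensity_eq_integral_toReal_smul (by fun_prop) (by simp)]
    simp [ENNReal.toReal_ofReal, (Real.exp_pos _).le, real_smul]
  have hchar : ∀ u : ℝ, ∫ x : ℝ, Complex.exp (Complex.I * ((u : ℂ) + (ω : ℂ) * Complex.I) * x) ∂μ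
      = charFun ν u := by
    intro u
    rw [charFun_apply_real, hν]
    congr with x
    rw [ofReal_exp, ← Complex.exp_add]
    congr 1
    push_cast
    linear_combination (ω * x : ℂ) * Complex.I_sq
  have hfour : ∀ w : ℝ, ∫ x : ℝ, Complex.exp
        (-Complex.I * (((2 * π * w : ℝ) : ℂ) + (ω : ℂ) * Complex.I) * x) * (g x : ℂ)
      = 𝓕 (fun x : ℝ ↦ ((Real.exp (ω * x) * g x : ℝ) : ℂ)) w := by
    intro w
    rw [Real.fourier_real_eq_integral_exp_smul]
    congr with x
    rw [ofReal_mul (Real.exp _), ofReal_exp, smul_eq_mul, ← mul_assoc, ← Complex.exp_add]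
    congr 2
    push_cast
    linear_combination -(ω * x : ℂ) * Complex.I_sq
  simp only [hchar] at hμhat ⊢
  have key := integral_eq_integral_charFun_mul_fourier ν hμhat hgint.ofReal
  simp only [RCLike.ofReal_eq_complex_ofReal] at key
  simp only [← hfour] at key
  rw [Measure.integral_comp_mul_left (fun u : ℝ ↦ charFun ν u * ∫ x : ℝ, Complex.exp
    (-Complex.I * ((u : ℂ) + (ω : ℂ) * Complex.I) * x) * (g x : ℂ)) (2 * π), hν] at key
  rw [← integral_complex_ofReal]
  convert key using 1
  · congr with x
    rw [← ofReal_mul, ← mul_assoc, ← Real.exp_add]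
    simp
  · rw [abs_of_pos (by positivity), real_smul]
    simp
end

section
/- (Power digital option pricing, Lemma 2.) Let ψ be an admissible characteristic exponent of order ν ∈ (0,2] and type [λ₋, λ₊], let τ > 0, x ∈ ℝ, r ∈ ℝ, and let Y be a real random variable with characteristic exponent ψ over time τ; set X = x + Y. Let a ≠ 0, γ, K ∈ ℝ, w ∈ {−1, 1}, and let ω > 0 satisfy a w ω + γ ∈ (−λ₊, −λ₋). Then E[e^{γX} 1(w a X ≥ w K)] is finite and e^{−rτ} E[e^{γX} 1(w a X ≥ w K)] = (w e^{γx} / (2πi)) ∫_{Im ξ = −wω} exp(i ξ (a x − K) − τ(r + ψ(a ξ − iγ))) · ξ^{−1} dξ, the integral being absolutely convergent. -/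
open MeasureTheory Real Complex ProbabilityTheory

/-- `ψ` is an admissible characteristic exponent of order `ν ∈ (0,2]` and type `[lm, lp]`
(`lm < 0 < lp`): continuous on the closed strip `lm ≤ Im ζ ≤ lp`, holomorphic in its
interior, vanishing at `0`, with `Re ψ(ζ) ≥ c|Re ζ|^ν − C` on the strip. -/
structure IsAdmissibleCharExponent (lm lp ν : ℝ) (ψ : ℂ → ℂ) : Prop where
  lm_neg : lm < 0
  lp_pos : 0 < lp
  ν_pos : 0 < ν
  ν_le_two : ν ≤ 2
  continuous : ContinuousOn ψ {ζ : ℂ | lm ≤ ζ.im ∧ ζ.im ≤ lp}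
  holomorphic : DifferentiableOn ℂ ψ {ζ : ℂ | lm < ζ.im ∧ ζ.im < lp}
  map_zero : ψ 0 = 0
  growth : ∃ c > 0, ∃ C ≥ 0, ∀ ζ : ℂ, lm ≤ ζ.im → ζ.im ≤ lp →
    c * |ζ.re| ^ ν - C ≤ (ψ ζ).re

/-- A real random variable `Y` on `(Ω, P)` has characteristic exponent `ψ` (of type
`[lm, lp]`) over time `τ`: `E[e^{−vY}] < ∞` for all `v ∈ [lm, lp]` and
`E[e^{iζY}] = e^{−τψ(ζ)}` for all `ζ` with `Im ζ ∈ [lm, lp]`. -/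
structure HasCharExponent {Ω : Type*} [MeasurableSpace Ω] (P : Measure Ω) (Y : Ω → ℝ)
    (lm lp : ℝ) (ψ : ℂ → ℂ) (τ : ℝ) : Prop where
  integrable_exp : ∀ v : ℝ, lm ≤ v → v ≤ lp → Integrable (fun s => Real.exp (-v * Y s)) P
  charFun_eq : ∀ ζ : ℂ, lm ≤ ζ.im → ζ.im ≤ lp →
    ∫ s, Complex.exp (Complex.I * ζ * (Y s : ℂ)) ∂P = Complex.exp (-(τ : ℂ) * ψ ζ)

/-- A finite measure on `ℝ` whose characteristic function is integrable has no atom at `0`. -/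
lemma measure_singleton_zero_of_integrable_charFun {μ : Measure ℝ} [IsFiniteMeasure μ]
    (h : Integrable (charFun μ)) : μ {0} = 0 := by
  have h_sinc : Filter.Tendsto (fun n : ℕ => ∫ x, sinc ((n : ℝ) * x) ∂μ) Filter.atTop
      (nhds (∫ x, ({0} : Set ℝ).indicator (fun _ => (1 : ℝ)) x ∂μ)) := by
    refine tendsto_integral_of_dominated_convergence (fun _ => (1 : ℝ)) (fun n => ?_)
      (integrable_const _) (fun n => .of_forall fun x => ?_) (.of_forall fun x => ?_)
    · exact (continuous_sinc.comp (by fun_prop)).aestronglyMeasurable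
    · simpa using abs_sinc_le_one _
    · by_cases hx : x = 0
      · simp [hx]
      · simp only [Set.mem_singleton_iff, hx, not_false_eq_true, Set.indicator_of_notMem]
        have h0 : Filter.Tendsto (fun n : ℕ => |x|⁻¹ * ((n : ℝ))⁻¹) Filter.atTop (nhds 0) := by
          simpa using (tendsto_inv_atTop_nhds_zero_nat (𝕜 := ℝ)).const_mul |x|⁻¹
        refine squeeze_zero_norm' ?_ h0
        filter_upwards [Filter.eventually_gt_atTop 0] with n hn
        have hn' : (0 : ℝ) < n := by exact_mod_cast hn
        have hnx : (n : ℝ) * x ≠ 0 := mul_ne_zero hn'.ne' hx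
        rw [sinc_of_ne_zero hnx, norm_div, Real.norm_eq_abs, Real.norm_eq_abs, abs_mul,
          abs_of_pos hn', div_eq_mul_inv, mul_inv, mul_comm (n : ℝ)⁻¹]
        exact mul_le_of_le_one_left (by positivity) (abs_sin_le_one _)
  have h_zero : Filter.Tendsto (fun n : ℕ => ∫ x, sinc ((n : ℝ) * x) ∂μ) Filter.atTop
      (nhds 0) := by
    have h0 : Filter.Tendsto (fun n : ℕ => (∫ t, ‖charFun μ t‖) * ((n : ℝ))⁻¹) Filter.atTop
        (nhds 0) := by
      simpa using (tendsto_inv_atTop_nhds_zero_nat (𝕜 := ℝ)).const_mul (∫ t, ‖charFun μ t‖)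
    refine squeeze_zero_norm' ?_ h0
    filter_upwards [Filter.eventually_gt_atTop 0] with n hn
    have hn' : (0 : ℝ) < n := by exact_mod_cast hn
    have key := integral_charFun_Icc (μ := μ) hn'
    have hle : ‖∫ t in -(n : ℝ)..n, charFun μ t‖ ≤ ∫ t, ‖charFun μ t‖ := by
      rw [intervalIntegral.integral_of_le (by linarith)]
      exact (norm_integral_le_integral_norm _).trans
        (setIntegral_le_integral h.norm (.of_forall fun _ => norm_nonneg _))
    rw [key] at hle
    have hnorm : ‖(2 * ((n : ℝ) : ℂ) * ((∫ x, sinc ((n : ℝ) * x) ∂μ : ℝ) : ℂ))‖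
        = 2 * n * ‖∫ x, sinc ((n : ℝ) * x) ∂μ‖ := by
      rw [norm_mul, norm_mul, Complex.norm_real, Complex.norm_real]
      simp
    rw [hnorm] at hle
    rw [← div_eq_mul_inv, le_div_iff₀ hn']
    nlinarith [norm_nonneg (∫ x, sinc ((n : ℝ) * x) ∂μ)]
  have := tendsto_nhds_unique h_sinc h_zero
  rw [integral_indicator (measurableSet_singleton 0)] at this
  simpa [Measure.real, ENNReal.toReal_eq_zero_iff] using this

/-- The Laplace-type transform of the half-line exponential kernel. -/
lemma integral_exp_mul_indicator_Ici {ω : ℝ} (hω : 0 < ω) (y : ℝ) :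
    ∫ s : ℝ, Complex.exp (y * s * I) *
        (Set.Ici (0 : ℝ)).indicator (fun s => (Real.exp (-ω * s) : ℂ)) s
      = 1 / (ω - y * I) := by
  have h1 : (fun s : ℝ => Complex.exp (y * s * I) *
        (Set.Ici (0 : ℝ)).indicator (fun s => (Real.exp (-ω * s) : ℂ)) s)
      = (Set.Ici (0 : ℝ)).indicator (fun s : ℝ => Complex.exp ((-ω + y * I) * s)) := by
    ext s
    by_cases hs : s ∈ Set.Ici (0 : ℝ)
    · simp only [Set.indicator_of_mem hs]
      rw [Complex.ofReal_exp, ← Complex.exp_add]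
      congr 1
      push_cast
      ring
    · simp [Set.indicator_of_notMem hs]
  have hre : (-(ω : ℂ) + y * I).re < 0 := by simpa using hω
  have hne : -(ω : ℂ) + y * I ≠ 0 := fun h => by simp [h] at hre
  have hne' : (ω : ℂ) - y * I ≠ 0 := fun h => hne (by linear_combination -h)
  rw [h1, integral_indicator measurableSet_Ici, integral_Ici_eq_integral_Ioi,
    integral_exp_mul_complex_Ioi hre 0]
  simp only [Complex.ofReal_zero, mul_zero, Complex.exp_zero]
  rw [div_eq_div_iff hne hne']
  ring

/-- Integrability of the half-line exponential kernel. -/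
lemma integrable_indicator_Ici_exp {ω : ℝ} (hω : 0 < ω) :
    Integrable ((Set.Ici (0 : ℝ)).indicator (fun s => (Real.exp (-ω * s) : ℂ))) := by
  rw [integrable_indicator_iff measurableSet_Ici, integrableOn_Ici_iff_integrableOn_Ioi]
  exact (integrableOn_exp_mul_Ioi (neg_lt_zero.mpr hω) 0).ofReal

/-- Parseval-type formula: for a finite measure with integrable characteristic function, the
truncated Laplace transform is a contour integral of the characteristic function. -/
lemma integral_indicator_Ici_exp_eq_integral_charFun {μ : Measure ℝ} [IsFiniteMeasure μ]
    (h : Integrable (charFun μ)) {ω : ℝ} (hω : 0 < ω) :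
    ∫ v, (Set.Ici (0 : ℝ)).indicator (fun s => (Real.exp (-ω * s) : ℂ)) v ∂μ
      = 1 / (2 * π) * ∫ u : ℝ, charFun μ u / (ω + u * I) := by
  set k : ℝ → ℂ := (Set.Ici (0 : ℝ)).indicator (fun s => (Real.exp (-ω * s) : ℂ)) with hk
  have hkm : Measurable k := by
    refine Measurable.indicator ?_ measurableSet_Ici
    fun_prop
  have hki : Integrable k := integrable_indicator_Ici_exp hω
  set G : ℝ → ℂ := fun t => ∫ v, k (v - t) ∂μ with hG
  have hprod : Integrable (fun p : ℝ × ℝ => k (p.2 - p.1)) (volume.prod μ) := by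
    have hm : AEStronglyMeasurable (fun p : ℝ × ℝ => k (p.2 - p.1)) (volume.prod μ) :=
      (hkm.comp (by fun_prop)).aestronglyMeasurable
    rw [integrable_prod_iff' hm]
    refine ⟨.of_forall fun v => hki.comp_sub_left v, ?_⟩
    have : (fun v : ℝ => ∫ t : ℝ, ‖k (v - t)‖) = fun _ => ∫ t, ‖k t‖ := by
      ext v
      exact integral_sub_left_eq_self (fun t => ‖k t‖) volume v
    rw [this]
    exact integrable_const _
  have hGi : Integrable G := hprod.integral_prod_left
  have hGF : ∀ y : ℝ, FourierTransform.fourier G y =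
      charFun μ (-2 * π * y) / (ω + (-2 * π * y : ℝ) * I) := by
    intro y
    rw [Real.fourier_real_eq_integral_exp_smul]
    simp only [hG, smul_eq_mul, ← integral_const_mul]
    rw [integral_integral_swap]
    · rw [charFun_apply_real, div_eq_mul_one_div, ← integral_mul_const]
      congr 1
      ext v
      rw [← integral_sub_left_eq_self _ volume v]
      have := integral_exp_mul_indicator_Ici hω (2 * π * y)
      rw [← hk] at this
      have h2 : (ω : ℂ) + (-2 * π * y : ℝ) * I = ω - (2 * π * y : ℝ) * I := by
        push_cast; ring
      rw [h2, ← this, ← integral_const_mul]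
      congr 1
      ext s
      rw [sub_sub_cancel, ← mul_assoc, ← Complex.exp_add]
      congr 2
      push_cast
      ring
    · refine hprod.bdd_mul (c := 1) ?_ ?_
      · exact Continuous.aestronglyMeasurable (by fun_prop)
      · exact .of_forall fun p => (Complex.norm_exp_ofReal_mul_I _).le
  have hq : Integrable (fun u : ℝ => charFun μ u / (ω + u * I)) := by
    have hne : ∀ u : ℝ, (ω : ℂ) + u * I ≠ 0 := fun u hu => by
      have := congrArg Complex.re hu
      simp at this
      exact hω.ne' this
    simp_rw [div_eq_mul_inv]
    refine h.mul_bdd (c := ω⁻¹) ?_ ?_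
    · exact Continuous.aestronglyMeasurable (by fun_prop (disch := exact hne))
    · refine .of_forall fun u => ?_
      rw [norm_inv]
      refine inv_anti₀ hω ?_
      simpa [abs_of_pos hω] using Complex.abs_re_le_norm ((ω : ℂ) + u * I)
  have hpi : (-2 * π : ℝ) ≠ 0 := by simp [pi_ne_zero]
  have hGF' : FourierTransform.fourier G =
      fun y : ℝ => (fun u : ℝ => charFun μ u / ((ω : ℂ) + u * I)) (-2 * π * y) := funext hGF
  have hGFi : Integrable (FourierTransform.fourier G) := by
    rw [hGF']
    exact hq.comp_mul_left' hpi
  have hcont : ContinuousAt G 0 := by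
    have hat : ∀ᵐ v ∂μ, v ≠ 0 := by
      rw [ae_iff]
      simpa using measure_singleton_zero_of_integrable_charFun h
    refine continuousAt_of_dominated (bound := fun _ => (1 : ℝ))
      (.of_forall fun t => (hkm.comp (by fun_prop)).aestronglyMeasurable)
      (.of_forall fun t => .of_forall fun v => ?_) (integrable_const _) ?_
    · simp only [hk]
      by_cases hs : v - t ∈ Set.Ici (0 : ℝ)
      · rw [Set.indicator_of_mem hs, Complex.norm_real, Real.norm_eq_abs, abs_of_pos (exp_pos _),
          Real.exp_le_one_iff]
        have : 0 ≤ v - t := hs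
        nlinarith
      · simp [Set.indicator_of_notMem hs]
    · filter_upwards [hat] with v hv
      have hk0 : ContinuousAt k (v - 0) := by
        rw [sub_zero]
        rcases hv.lt_or_gt with hv | hv
        · refine (continuousAt_const (y := (0 : ℂ))).congr ?_
          filter_upwards [eventually_lt_nhds hv] with s hs
          simp [hk, hs]
        · have : ContinuousAt (fun s : ℝ => (Real.exp (-ω * s) : ℂ)) v :=
            Continuous.continuousAt (by fun_prop)
          refine this.congr ?_
          filter_upwards [eventually_gt_nhds hv] with s hs
          simp [hk, hs.le]
      exact ContinuousAt.comp (f := fun t : ℝ => v - t) hk0 (by fun_prop)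
  have hinv := hGi.fourierInv_fourier_eq hGFi hcont
  have hG0 : G 0 = ∫ v, k v ∂μ := by simp [hG]
  rw [← hG0, ← hinv, Real.fourierInv_eq']
  simp only [inner_zero_right, mul_zero, Complex.ofReal_zero, zero_mul, Complex.exp_zero, one_smul]
  rw [hGF', Measure.integral_comp_mul_left (fun u : ℝ => charFun μ u / ((ω : ℂ) + u * I))]
  have : |(-2 * π : ℝ)⁻¹| = 1 / (2 * π) := by
    rw [abs_inv, abs_mul, abs_of_pos pi_pos]
    simp
  rw [this, Complex.real_smul]
  push_cast
  ring

/-- Stretched exponentials are integrable on the line. -/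
lemma integrable_exp_neg_mul_abs_rpow {b p : ℝ} (hb : 0 < b) (hp : 0 < p) :
    Integrable (fun u : ℝ => Real.exp (-b * |u| ^ p)) := by
  have h1 : IntegrableOn (fun u : ℝ => Real.exp (-b * u ^ p)) (Set.Ioi 0) := by
    by_contra hcon
    have h2 := integral_exp_neg_mul_rpow hp hb
    rw [integral_undef hcon] at h2
    have : 0 < b ^ (-1 / p) * Real.Gamma (1 / p + 1) :=
      mul_pos (rpow_pos_of_pos hb _) (Real.Gamma_pos_of_pos (by positivity))
    linarith
  have h2 : IntegrableOn (fun u : ℝ => Real.exp (-b * |u| ^ p)) (Set.Ioi 0) :=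
    h1.congr_fun (fun u hu => by simp only [abs_of_pos (Set.mem_Ioi.mp hu)]) measurableSet_Ioi
  rw [← integrableOn_univ, ← Set.Iic_union_Ioi (a := (0 : ℝ))]
  refine IntegrableOn.union ?_ h2
  rw [integrableOn_Iic_iff_integrableOn_Iio]
  have h3 := IntegrableOn.comp_neg_Iio (c := (0 : ℝ)) (by simpa using h2)
  simpa using h3

/-- The exponentially tilted law of `V`: the law of `V` under the measure with density `D`. -/
noncomputable def tiltedLaw {Ω : Type*} [MeasurableSpace Ω] (P : Measure Ω) (D V : Ω → ℝ) :
    Measure ℝ :=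
  (P.withDensity (fun s => ENNReal.ofReal (D s))).map V

lemma isFiniteMeasure_tiltedLaw {Ω : Type*} [MeasurableSpace Ω] {P : Measure Ω} {D V : Ω → ℝ}
    (hD : Integrable D P) : IsFiniteMeasure (tiltedLaw P D V) := by
  have := isFiniteMeasure_withDensity_ofReal hD.2
  unfold tiltedLaw
  infer_instance

lemma integral_tiltedLaw {Ω : Type*} [MeasurableSpace Ω] {P : Measure Ω} {D V : Ω → ℝ}
    (hD : Integrable D P) (hD0 : ∀ s, 0 ≤ D s) (hV : AEMeasurable V P) {f : ℝ → ℂ}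
    (hf : Measurable f) :
    ∫ v, f v ∂(tiltedLaw P D V) = ∫ s, (D s : ℂ) * f (V s) ∂P := by
  rw [tiltedLaw, integral_map (hV.mono_ac (withDensity_absolutelyContinuous _ _))
    hf.aestronglyMeasurable, integral_withDensity_eq_integral_toReal_smul₀
      hD.aemeasurable.ennreal_ofReal (.of_forall fun _ => ENNReal.ofReal_lt_top)]
  simp [ENNReal.toReal_ofReal (hD0 _)]

/-- A random variable with a characteristic exponent is almost everywhere measurable. -/
lemma HasCharExponent.aemeasurable {Ω : Type*} [MeasurableSpace Ω] {P : Measure Ω} {Y : Ω → ℝ}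
    {lm lp : ℝ} {ψ : ℂ → ℂ} {τ : ℝ} (hY : HasCharExponent P Y lm lp ψ τ) (hm : lm < 0)
    (hp : 0 < lp) : AEMeasurable Y P := by
  have h := (hY.integrable_exp lp (hm.trans hp).le le_rfl).aemeasurable
  have h2 := (Real.measurable_log.comp_aemeasurable h).const_mul (-lp⁻¹)
  refine h2.congr (.of_forall fun s => ?_)
  simp only [Function.comp_apply, Real.log_exp]
  field_simp

/-- Power digital option pricing (Lemma 2). -/
theorem stmt5 {Ω : Type*} [MeasurableSpace Ω] (P : Measure Ω) [IsProbabilityMeasure P]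
    (lm lp ν : ℝ) (ψ : ℂ → ℂ) (hψ : IsAdmissibleCharExponent lm lp ν ψ)
    (τ : ℝ) (hτ : 0 < τ) (x r : ℝ) (Y : Ω → ℝ) (hY : HasCharExponent P Y lm lp ψ τ)
    (a γ K w ω : ℝ) (ha : a ≠ 0) (hw : w = 1 ∨ w = -1) (hω : 0 < ω)
    (hstrip₁ : -lp < a * w * ω + γ) (hstrip₂ : a * w * ω + γ < -lm) :
    Integrable (fun s => Real.exp (γ * (x + Y s)) *
      (if w * (a * (x + Y s)) ≥ w * K then (1 : ℝ) else 0)) P ∧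
    Integrable (fun u : ℝ =>
      Complex.exp (Complex.I * ((u : ℂ) - (w * ω : ℝ) * Complex.I) * ((a * x - K : ℝ) : ℂ)
          - (τ : ℂ) * ((r : ℂ) + ψ ((a : ℂ) * ((u : ℂ) - (w * ω : ℝ) * Complex.I)
              - Complex.I * (γ : ℂ))))
        / ((u : ℂ) - (w * ω : ℝ) * Complex.I)) ∧
    ((Real.exp (-r * τ) * ∫ s, Real.exp (γ * (x + Y s)) *
        (if w * (a * (x + Y s)) ≥ w * K then (1 : ℝ) else 0) ∂P : ℝ) : ℂ)
      = ((w : ℂ) * Real.exp (γ * x) / (2 * Real.pi * Complex.I)) *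
          ∫ u : ℝ,
            Complex.exp (Complex.I * ((u : ℂ) - (w * ω : ℝ) * Complex.I) * ((a * x - K : ℝ) : ℂ)
                - (τ : ℂ) * ((r : ℂ) + ψ ((a : ℂ) * ((u : ℂ) - (w * ω : ℝ) * Complex.I)
                    - Complex.I * (γ : ℂ))))
              / ((u : ℂ) - (w * ω : ℝ) * Complex.I) := by
  have hlm := hψ.lm_neg
  have hlp := hψ.lp_pos
  have hww : w * w = 1 := by rcases hw with rfl | rfl <;> norm_num
  have hw0 : w ≠ 0 := fun h => by simp [h] at hww
  have hwC : (w : ℂ) ≠ 0 := by exact_mod_cast hw0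
  have hYm : AEMeasurable Y P := hY.aemeasurable hlm hlp
  set V : Ω → ℝ := fun s => w * (a * (x + Y s) - K) with hV
  set D : Ω → ℝ := fun s => Real.exp (γ * (x + Y s) + ω * V s) with hD
  have hVm : AEMeasurable V P := by fun_prop
  have hDi : Integrable D P := by
    have h := (hY.integrable_exp (-(a * w * ω + γ)) (by linarith) (by linarith)).const_mul
      (Real.exp (γ * x + ω * w * (a * x - K)))
    refine h.congr (.of_forall fun s => ?_)
    simp only [hD, hV, ← Real.exp_add]
    congr 1
    ring
  have hD0 : ∀ s, 0 ≤ D s := fun s => (Real.exp_pos _).le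
  have := isFiniteMeasure_tiltedLaw (V := V) hDi
  set μ := tiltedLaw P D V with hμ
  have hpay : ∀ s, Real.exp (γ * (x + Y s)) *
      (if w * (a * (x + Y s)) ≥ w * K then (1 : ℝ) else 0)
      = D s * (Set.Ici (0 : ℝ)).indicator (fun t => Real.exp (-ω * t)) (V s) := by
    intro s
    have hiff : w * (a * (x + Y s)) ≥ w * K ↔ V s ∈ Set.Ici (0 : ℝ) := by
      simp only [hV, Set.mem_Ici, mul_sub, sub_nonneg, ge_iff_le]
    by_cases hs : V s ∈ Set.Ici (0 : ℝ)
    · rw [if_pos (hiff.mpr hs), Set.indicator_of_mem hs, mul_one, hD, ← Real.exp_add]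
      congr 1
      ring
    · rw [if_neg (mt hiff.mp hs), Set.indicator_of_notMem hs, mul_zero, mul_zero]
  have hkm : Measurable ((Set.Ici (0 : ℝ)).indicator (fun t => Real.exp (-ω * t))) :=
    Measurable.indicator (by fun_prop) measurableSet_Ici
  set ξ : ℝ → ℂ := fun u => (u : ℂ) - (w * ω : ℝ) * I with hξ
  have hξ0 : ∀ u, ξ u ≠ 0 := fun u hu => by
    have := congrArg Complex.im hu
    simp [hξ, hw0, hω.ne'] at this
  set F : ℝ → ℂ := fun u => Complex.exp (I * ξ u * ((a * x - K : ℝ) : ℂ) + γ * x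
    - τ * ψ (a * ξ u - I * γ)) with hF
  have him : ∀ u : ℝ, ((a : ℂ) * ξ u - I * γ).im = -(a * w * ω + γ) := fun u => by
    simp [hξ]; ring
  have hre : ∀ u : ℝ, ((a : ℂ) * ξ u - I * γ).re = a * u := fun u => by simp [hξ]
  have hchar : ∀ u, charFun μ u = F (w * u) := by
    intro u
    have hY' := hY.charFun_eq (a * ξ (w * u) - I * γ) (by rw [him]; linarith)
      (by rw [him]; linarith)
    rw [charFun_apply_real, hμ, integral_tiltedLaw hDi hD0 hVm (by fun_prop), hF]
    simp only
    rw [sub_eq_add_neg, Complex.exp_add, ← neg_mul, ← hY', ← integral_const_mul]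
    congr 1
    ext s
    simp only [hD, Complex.ofReal_exp, ← Complex.exp_add, hV, hξ]
    congr 1
    push_cast
    linear_combination
      -((-(ω : ℂ) * w * (a * x - K) - (γ + a * w * ω) * Y s) * Complex.I_sq)
  have hFchar : ∀ u, F u = charFun μ (w * u) := fun u => by
    rw [hchar, ← mul_assoc, hww, one_mul]
  have hFi : Integrable F := by
    obtain ⟨c, hc, C, hC, hgrow⟩ := hψ.growth
    have hb : 0 < τ * (c * |a| ^ ν) := by
      have := abs_pos.mpr ha
      positivity
    refine ((integrable_exp_neg_mul_abs_rpow hb hψ.ν_pos).const_mul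
      (Real.exp (w * ω * (a * x - K) + γ * x + τ * C))).mono' ?_ (.of_forall fun u => ?_)
    · rw [funext hFchar]
      exact (measurable_charFun.comp (by fun_prop)).aestronglyMeasurable
    · have hg := hgrow (a * ξ u - I * γ) (by rw [him]; linarith) (by rw [him]; linarith)
      rw [hre, abs_mul, mul_rpow (abs_nonneg _) (abs_nonneg _)] at hg
      rw [hF, Complex.norm_exp, ← Real.exp_add]
      have h1 : (I * ξ u * ((a * x - K : ℝ) : ℂ) + γ * x).re = w * ω * (a * x - K) + γ * x := by
        simp [hξ]
      have h2 : ((τ : ℂ) * ψ (a * ξ u - I * γ)).re = τ * (ψ (a * ξ u - I * γ)).re := by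
        simp
      rw [Complex.sub_re, h1, h2, Real.exp_le_exp]
      nlinarith [mul_le_mul_of_nonneg_left hg hτ.le]
  have hμi : Integrable (charFun μ) := by
    rw [funext hchar]
    exact hFi.comp_mul_left' hw0
  have hinteg : ∀ u : ℝ, Complex.exp (I * ((u : ℂ) - (w * ω : ℝ) * I) * ((a * x - K : ℝ) : ℂ)
      - (τ : ℂ) * ((r : ℂ) + ψ ((a : ℂ) * ((u : ℂ) - (w * ω : ℝ) * I) - I * (γ : ℂ))))
        / ((u : ℂ) - (w * ω : ℝ) * I)
      = Complex.exp (-r * τ - γ * x) * (F u / ξ u) := by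
    intro u
    rw [hF, ← mul_div_assoc, ← Complex.exp_add, hξ]
    congr 2
    ring
  have hquot : Integrable (fun u => F u / ξ u) := by
    simp_rw [div_eq_mul_inv]
    refine hFi.mul_bdd (c := ω⁻¹) ?_ (.of_forall fun u => ?_)
    · exact Continuous.aestronglyMeasurable (by fun_prop (disch := exact hξ0))
    · rw [norm_inv]
      refine inv_anti₀ hω ?_
      have h1 : |(ξ u).im| = ω := by
        rcases hw with rfl | rfl <;> simp [hξ, abs_of_pos hω]
      exact h1 ▸ Complex.abs_im_le_norm (ξ u)
  simp_rw [hinteg, hpay]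
  refine ⟨?_, hquot.const_mul _, ?_⟩
  · refine hDi.mul_bdd (c := 1) (hkm.comp_aemeasurable hVm).aestronglyMeasurable
      (.of_forall fun s => ?_)
    by_cases hs : V s ∈ Set.Ici (0 : ℝ)
    · rw [Set.indicator_of_mem hs, Real.norm_eq_abs, abs_of_pos (Real.exp_pos _),
        Real.exp_le_one_iff]
      have : 0 ≤ V s := hs
      nlinarith
    · simp [Set.indicator_of_notMem hs]
  · have hL : ((∫ s, D s *
          (Set.Ici (0 : ℝ)).indicator (fun t => Real.exp (-ω * t)) (V s) ∂P : ℝ) : ℂ)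
        = ∫ v, (Set.Ici (0 : ℝ)).indicator (fun t => (Real.exp (-ω * t) : ℂ)) v ∂μ := by
      rw [hμ, integral_tiltedLaw hDi hD0 hVm
        (Measurable.indicator (by fun_prop) measurableSet_Ici), ← integral_complex_ofReal]
      congr 1
      ext s
      by_cases hs : V s ∈ Set.Ici (0 : ℝ)
      · simp only [Set.indicator_of_mem hs]
        push_cast
        rfl
      · simp only [Set.indicator_of_notMem hs, mul_zero, Complex.ofReal_zero]
    have hR : ∫ u : ℝ, charFun μ u / (ω + u * I) = (w / I) * ∫ u, F u / ξ u := by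
      have h1 : ∀ u : ℝ, charFun μ u / (ω + u * I)
          = (w / I) * (fun u => F u / ξ u) (w * u) := by
        intro u
        have h2 : (ω : ℂ) + u * I = I / w * ξ (w * u) := by
          simp only [hξ]
          push_cast
          field_simp
          linear_combination (ω : ℂ) * Complex.I_sq
        rw [h2, hchar]
        have := hξ0 (w * u)
        field_simp
      simp_rw [h1]
      rw [integral_const_mul, Measure.integral_comp_mul_left (fun u => F u / ξ u)]
      have h3 : |w⁻¹| = 1 := by rcases hw with rfl | rfl <;> norm_num
      rw [h3, one_smul]
    rw [Complex.ofReal_mul, hL, integral_indicator_Ici_exp_eq_integral_charFun hμi hω, hR,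
      integral_const_mul]
    have he : Complex.exp (-r * τ - γ * x) = Real.exp (-r * τ) / Real.exp (γ * x) := by
      rw [Complex.exp_sub]
      push_cast
      rfl
    rw [he]
    have hne : (Real.exp (γ * x) : ℂ) ≠ 0 := by exact_mod_cast (Real.exp_pos _).ne'
    have hpi : (π : ℂ) ≠ 0 := by exact_mod_cast pi_ne_zero
    field_simp
end

section
/- (Chooser option price in the Black–Scholes model.) Let σ > 0, r ∈ ℝ, x ∈ ℝ, K > 0 and t < T₁ < T. Let X_{T₁} = x + (r − σ²/2)(T₁ − t) + σ Z₁ and X_T = X_{T₁} + (r − σ²/2)(T − T₁) + σ Z₂, where Z₁, Z₂ are independent centered Gaussian random variables with variances T₁ − t and T − T₁ respectively; set S = e^x. Then e^{−r(T−t)} E[ (e^{X_T} − K) 1(e^{X_T} > K) 1(e^{X_{T₁}} > K e^{−r(T−T₁)}) + (K − e^{X_T}) 1(e^{X_T} < K) 1(e^{X_{T₁}} < K e^{−r(T−T₁)}) ] = S (Φ(d_T⁺) − Φ(−d_{T,T₁}⁺)) − K e^{−r(T−t)} (Φ(d_T⁻) − Φ(−d_{T,T₁}⁻)), where d_T^±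 = (ln(S/K) + (r ± σ²/2)(T − t)) / (σ√(T − t)) and d_{T,T₁}^± = (ln(S/K) + r(T − T₁) + (r ± σ²/2)(T₁ − t)) / (σ√(T₁ − t)). -/
open MeasureTheory Real Complex ProbabilityTheory

/-- The standard normal cumulative distribution function. -/
noncomputable def stdNormalCDF (x : ℝ) : ℝ :=
  ∫ t in Set.Iic x, (Real.sqrt (2 * Real.pi))⁻¹ * Real.exp (-t ^ 2 / 2)

/-- An exponential moment of a centered Gaussian variable, restricted to a lower half-line. -/
lemma integral_indicator_exp_mul_gaussianReal_Iio {v : NNReal} (hv : v ≠ 0) (c a : ℝ) :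
    ∫ z, (Set.Iio a).indicator (fun z => Real.exp (c * z)) z ∂(gaussianReal 0 v)
      = Real.exp (c ^ 2 * v / 2) * stdNormalCDF ((a - c * v) / Real.sqrt v) := by
  have hv' : (0 : ℝ) < v := by positivity
  have hs : 0 < Real.sqrt v := Real.sqrt_pos.mpr hv'
  have hsq : Real.sqrt v ^ 2 = v := Real.sq_sqrt hv'.le
  set w := Real.sqrt v with hw
  rw [integral_gaussianReal_eq_integral_smul hv]
  set g : ℝ → ℝ := fun z =>
    gaussianPDFReal 0 v z • (Set.Iio a).indicator (fun z => Real.exp (c * z)) z with hg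
  have hsubst : ∫ u, g (w * u + c * v) = w⁻¹ * ∫ z, g z := by
    rw [Measure.integral_comp_mul_left (fun u => g (u + c * v)) w, abs_of_pos (inv_pos.mpr hs),
      smul_eq_mul, integral_add_right_eq_self g]
  have hval : ∫ z, g z = w * ∫ u, g (w * u + c * v) := by
    rw [hsubst, mul_inv_cancel_left₀ hs.ne']
  rw [hval, stdNormalCDF, integral_Iic_eq_integral_Iio, ← integral_indicator measurableSet_Iio,
    ← integral_const_mul, ← integral_const_mul]
  congr 1
  ext u
  have hmem : w * u + c * v ∈ Set.Iio a ↔ u ∈ Set.Iio ((a - c * v) / w) := by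
    simp only [Set.mem_Iio]
    rw [lt_div_iff₀ hs]
    constructor <;> intro h <;> linarith
  by_cases h : u ∈ Set.Iio ((a - c * v) / w)
  · rw [hg]
    simp only [smul_eq_mul]
    rw [Set.indicator_of_mem (hmem.mpr h), Set.indicator_of_mem h, gaussianPDFReal,
      Real.sqrt_mul (by positivity), ← hw, mul_inv]
    have hexp : Real.exp (-(w * u + c * v - 0) ^ 2 / (2 * v)) * Real.exp (c * (w * u + c * v))
        = Real.exp (c ^ 2 * v / 2) * Real.exp (-u ^ 2 / 2) := by
      rw [← Real.exp_add, ← Real.exp_add, ← hsq]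
      congr 1
      field_simp
      ring
    calc _ = (w * w⁻¹) * (Real.sqrt (2 * Real.pi))⁻¹ *
          (Real.exp (-(w * u + c * v - 0) ^ 2 / (2 * v)) * Real.exp (c * (w * u + c * v))) := by
            ring
      _ = _ := by rw [hexp, mul_inv_cancel₀ hs.ne']; ring
  · rw [hg]
    simp only [smul_eq_mul]
    rw [Set.indicator_of_notMem (fun h' => h (hmem.mp h')), Set.indicator_of_notMem h]
    simp

/-- An exponential moment of a centered Gaussian variable, restricted to an upper half-line. -/
lemma integral_indicator_exp_mul_gaussianReal_Ioi {v : NNReal} (hv : v ≠ 0) (c a : ℝ) :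
    ∫ z, (Set.Ioi a).indicator (fun z => Real.exp (c * z)) z ∂(gaussianReal 0 v)
      = Real.exp (c ^ 2 * v / 2) * stdNormalCDF ((c * v - a) / Real.sqrt v) := by
  have hneg : (gaussianReal 0 v).map (fun z => -z) = gaussianReal 0 v := by
    simpa using gaussianReal_map_neg (μ := 0) (v := v)
  have hmeas : Measurable ((Set.Ioi a).indicator (fun z => Real.exp (c * z))) :=
    Measurable.indicator (by fun_prop) measurableSet_Ioi
  rw [← hneg, integral_map (by fun_prop) hmeas.aestronglyMeasurable]
  have h := integral_indicator_exp_mul_gaussianReal_Iio hv (-c) (-a)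
  rw [show -a - -c * (v : ℝ) = c * v - a by ring, neg_sq] at h
  rw [← h]
  congr 1
  ext z
  simp only [Set.indicator_apply, Set.mem_Ioi, Set.mem_Iio, lt_neg, mul_neg, neg_mul]

/-- The exponential of a multiple of a Gaussian variable, restricted to a measurable event, is
integrable. -/
lemma integrable_indicator_exp_mul_of_map_eq_gaussianReal {Ω : Type*} [MeasurableSpace Ω]
    {P : Measure Ω} {Z : Ω → ℝ} {m : ℝ} {v : NNReal} (hZ : Measurable Z)
    (hlaw : P.map Z = gaussianReal m v) {A : Set ℝ} (hA : MeasurableSet A) (c : ℝ) :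
    Integrable (fun s => A.indicator (fun z => Real.exp (c * z)) (Z s)) P := by
  have h : Integrable (A.indicator (fun z => Real.exp (c * z))) (P.map Z) := by
    rw [hlaw]
    exact (integrable_exp_mul_gaussianReal c).indicator hA
  exact h.comp_measurable hZ

/-- Change of variables for a restricted exponential moment. -/
lemma integral_indicator_exp_mul_of_map_eq {Ω : Type*} [MeasurableSpace Ω]
    {P : Measure Ω} {Z : Ω → ℝ} {μ : Measure ℝ} (hZ : Measurable Z)
    (hlaw : P.map Z = μ) {A : Set ℝ} (hA : MeasurableSet A) (c : ℝ) :
    ∫ s, A.indicator (fun z => Real.exp (c * z)) (Z s) ∂P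
      = ∫ z, A.indicator (fun z => Real.exp (c * z)) z ∂μ := by
  have hmeas : Measurable (A.indicator (fun z => Real.exp (c * z))) :=
    Measurable.indicator (by fun_prop) hA
  rw [← hlaw, integral_map hZ.aemeasurable hmeas.aestronglyMeasurable]

/-- Chooser option price in the Black–Scholes model. -/
theorem stmt16 {Ω : Type*} [MeasurableSpace Ω] (P : Measure Ω) [IsProbabilityMeasure P]
    (σ r x K t T₁ T : ℝ) (hσ : 0 < σ) (hK : 0 < K) (ht : t < T₁) (hT : T₁ < T)
    (Z₁ Z₂ : Ω → ℝ) (hm₁ : Measurable Z₁) (hm₂ : Measurable Z₂)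
    (hind : IndepFun Z₁ Z₂ P)
    (hg₁ : Measure.map Z₁ P = gaussianReal 0 (T₁ - t).toNNReal)
    (hg₂ : Measure.map Z₂ P = gaussianReal 0 (T - T₁).toNNReal)
    (X₁ XT : Ω → ℝ)
    (hX₁ : ∀ s, X₁ s = x + (r - σ ^ 2 / 2) * (T₁ - t) + σ * Z₁ s)
    (hXT : ∀ s, XT s = X₁ s + (r - σ ^ 2 / 2) * (T - T₁) + σ * Z₂ s) :
    Real.exp (-r * (T - t)) *
      ∫ s, ((Real.exp (XT s) - K) *
          (if Real.exp (XT s) > K then (1 : ℝ) else 0) *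
          (if Real.exp (X₁ s) > K * Real.exp (-r * (T - T₁)) then (1 : ℝ) else 0)
        + (K - Real.exp (XT s)) *
          (if Real.exp (XT s) < K then (1 : ℝ) else 0) *
          (if Real.exp (X₁ s) < K * Real.exp (-r * (T - T₁)) then (1 : ℝ) else 0)) ∂P
      = Real.exp x *
          (stdNormalCDF ((Real.log (Real.exp x / K) + (r + σ ^ 2 / 2) * (T - t))
              / (σ * Real.sqrt (T - t)))
            - stdNormalCDF (-((Real.log (Real.exp x / K) + r * (T - T₁)
                + (r + σ ^ 2 / 2) * (T₁ - t)) / (σ * Real.sqrt (T₁ - t)))))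
        - K * Real.exp (-r * (T - t)) *
          (stdNormalCDF ((Real.log (Real.exp x / K) + (r - σ ^ 2 / 2) * (T - t))
              / (σ * Real.sqrt (T - t)))
            - stdNormalCDF (-((Real.log (Real.exp x / K) + r * (T - T₁)
                + (r - σ ^ 2 / 2) * (T₁ - t)) / (σ * Real.sqrt (T₁ - t))))) := by
  have hτ₁ : 0 < T₁ - t := sub_pos.mpr ht
  have hτ₂ : 0 < T - T₁ := sub_pos.mpr hT
  have hτ : 0 < T - t := by linarith
  have hv₁ : (T₁ - t).toNNReal ≠ 0 := (Real.toNNReal_pos.mpr hτ₁).ne'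
  have hv : (T - t).toNNReal ≠ 0 := (Real.toNNReal_pos.mpr hτ).ne'
  have hc₁ : ((T₁ - t).toNNReal : ℝ) = T₁ - t := Real.coe_toNNReal _ hτ₁.le
  have hc₂ : ((T - T₁).toNNReal : ℝ) = T - T₁ := Real.coe_toNNReal _ hτ₂.le
  have hc : ((T - t).toNNReal : ℝ) = T - t := Real.coe_toNNReal _ hτ.le
  have hgW : P.map (Z₁ + Z₂) = gaussianReal 0 (T - t).toNNReal := by
    rw [gaussianReal_add_gaussianReal_of_indepFun hind hg₁ hg₂,
      ← Real.toNNReal_add hτ₁.le hτ₂.le]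
    congr 2 <;> ring
  have hmW : Measurable (Z₁ + Z₂) := hm₁.add hm₂
  obtain ⟨m, hm⟩ : ∃ m, m = x + (r - σ ^ 2 / 2) * (T - t) := ⟨_, rfl⟩
  obtain ⟨a, ha⟩ : ∃ a, a = (Real.log K - m) / σ := ⟨_, rfl⟩
  obtain ⟨b, hb⟩ : ∃ b, b =
    (Real.log K - r * (T - T₁) - (x + (r - σ ^ 2 / 2) * (T₁ - t))) / σ := ⟨_, rfl⟩
  have hXTW : ∀ s, XT s = m + σ * (Z₁ + Z₂) s := by
    intro s
    rw [hXT, hX₁, hm, Pi.add_apply]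
    ring
  have hσa : σ * a = Real.log K - m := by rw [ha]; field_simp
  have hσb : σ * b = Real.log K - r * (T - T₁) - (x + (r - σ ^ 2 / 2) * (T₁ - t)) := by
    rw [hb]; field_simp
  have hlogk : K * Real.exp (-r * (T - T₁)) = Real.exp (Real.log K - r * (T - T₁)) := by
    rw [sub_eq_add_neg (Real.log K), Real.exp_add, Real.exp_log hK, neg_mul]
  have hgtK : ∀ s, Real.exp (XT s) > K ↔ a < (Z₁ + Z₂) s := by
    intro s
    rw [gt_iff_lt, ← Real.log_lt_iff_lt_exp hK, hXTW, ← mul_lt_mul_iff_right₀ hσ (b := a), hσa]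
    constructor <;> intro h <;> linarith
  have hltk : ∀ s, Real.exp (X₁ s) < K * Real.exp (-r * (T - T₁)) ↔ Z₁ s < b := by
    intro s
    rw [hlogk, Real.exp_lt_exp, hX₁, ← mul_lt_mul_iff_right₀ hσ (c := b), hσb]
    constructor <;> intro h <;> linarith
  have hne : ∀ᵐ s ∂P, Z₁ s ≠ b := by
    have := nullSingletonClass_gaussianReal (μ := 0) hv₁
    have h0 : P.map Z₁ {b} = 0 := by rw [hg₁]; exact measure_singleton b
    rw [Measure.map_apply hm₁ (measurableSet_singleton b)] at h0
    exact measure_eq_zero_iff_ae_notMem.mp h0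
  have hI₁ : Integrable (fun s => (Set.Ioi a).indicator (fun z => Real.exp (σ * z))
      ((Z₁ + Z₂) s)) P :=
    integrable_indicator_exp_mul_of_map_eq_gaussianReal hmW hgW measurableSet_Ioi σ
  have hI₂ : Integrable (fun s => (Set.Ioi a).indicator (fun z => Real.exp (0 * z))
      ((Z₁ + Z₂) s)) P :=
    integrable_indicator_exp_mul_of_map_eq_gaussianReal hmW hgW measurableSet_Ioi 0
  have hI₃ : Integrable (fun s => (Set.Iio b).indicator (fun z => Real.exp (0 * z)) (Z₁ s)) P :=
    integrable_indicator_exp_mul_of_map_eq_gaussianReal hm₁ hg₁ measurableSet_Iio 0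
  have hJ₁ : Integrable (fun s => (Set.Iio b).indicator (fun z => Real.exp (σ * z)) (Z₁ s)) P :=
    integrable_indicator_exp_mul_of_map_eq_gaussianReal hm₁ hg₁ measurableSet_Iio σ
  have hJ₂ : Integrable (fun s => Real.exp (σ * Z₂ s)) P := by
    simpa using
      integrable_indicator_exp_mul_of_map_eq_gaussianReal hm₂ hg₂ MeasurableSet.univ σ
  have hindJ : IndepFun (fun s => (Set.Iio b).indicator (fun z => Real.exp (σ * z)) (Z₁ s))
      (fun s => Real.exp (σ * Z₂ s)) P :=
    hind.comp (φ := (Set.Iio b).indicator (fun z => Real.exp (σ * z)))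
      (ψ := fun z => Real.exp (σ * z))
      (Measurable.indicator (by fun_prop) measurableSet_Iio) (by fun_prop)
  have hI₄ : Integrable (fun s => (Set.Iio b).indicator (fun z => Real.exp (σ * z)) (Z₁ s) *
      Real.exp (σ * Z₂ s)) P := hindJ.integrable_mul hJ₁ hJ₂
  have hmgf : ∫ s, Real.exp (σ * Z₂ s) ∂P = Real.exp (σ ^ 2 * (T - T₁) / 2) := by
    have h := mgf_gaussianReal hg₂ σ
    rw [mgf, hc₂] at h
    rw [h]
    congr 1
    ring
  have hE₁ := integral_indicator_exp_mul_of_map_eq hmW hgW (measurableSet_Ioi (a := a)) σ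
  have hE₂ := integral_indicator_exp_mul_of_map_eq hmW hgW (measurableSet_Ioi (a := a)) 0
  have hE₃ := integral_indicator_exp_mul_of_map_eq hm₁ hg₁ (measurableSet_Iio (a := b)) 0
  have hE₄ := hindJ.integral_fun_mul_eq_mul_integral hJ₁.aestronglyMeasurable
    hJ₂.aestronglyMeasurable
  rw [integral_indicator_exp_mul_of_map_eq hm₁ hg₁ measurableSet_Iio σ, hmgf,
    integral_indicator_exp_mul_gaussianReal_Iio hv₁, hc₁] at hE₄
  rw [integral_indicator_exp_mul_gaussianReal_Ioi hv, hc] at hE₁ hE₂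
  rw [integral_indicator_exp_mul_gaussianReal_Iio hv₁, hc₁] at hE₃
  have hpayoff : ∀ᵐ s ∂P, ((Real.exp (XT s) - K) *
          (if Real.exp (XT s) > K then (1 : ℝ) else 0) *
          (if Real.exp (X₁ s) > K * Real.exp (-r * (T - T₁)) then (1 : ℝ) else 0)
        + (K - Real.exp (XT s)) *
          (if Real.exp (XT s) < K then (1 : ℝ) else 0) *
          (if Real.exp (X₁ s) < K * Real.exp (-r * (T - T₁)) then (1 : ℝ) else 0))
      = Real.exp m * (Set.Ioi a).indicator (fun z => Real.exp (σ * z)) ((Z₁ + Z₂) s)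
        - K * (Set.Ioi a).indicator (fun z => Real.exp (0 * z)) ((Z₁ + Z₂) s)
        + K * (Set.Iio b).indicator (fun z => Real.exp (0 * z)) (Z₁ s)
        - Real.exp m * ((Set.Iio b).indicator (fun z => Real.exp (σ * z)) (Z₁ s) *
            Real.exp (σ * Z₂ s)) := by
    filter_upwards [hne] with s hs
    have hne' : Real.exp (X₁ s) ≠ K * Real.exp (-r * (T - T₁)) := by
      intro h
      rw [hlogk, Real.exp_eq_exp, hX₁] at h
      exact hs (mul_left_cancel₀ hσ.ne' (by rw [hσb]; linarith))
    have hexp : Real.exp (XT s) = Real.exp m * Real.exp (σ * (Z₁ + Z₂) s) := by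
      rw [hXTW, Real.exp_add]
    have hexp' : Real.exp (XT s) = Real.exp m * (Real.exp (σ * Z₁ s) * Real.exp (σ * Z₂ s)) := by
      rw [hexp, Pi.add_apply, mul_add, Real.exp_add]
    simp only [Set.indicator_apply, Set.mem_Ioi, Set.mem_Iio, ← hgtK, ← hltk, zero_mul,
      Real.exp_zero]
    rcases lt_or_gt_of_ne hne' with h₁ | h₁
    · rcases lt_trichotomy (Real.exp (XT s)) K with h | h | h
      · simp only [h, h₁, h.not_gt, h₁.not_gt, if_true, if_false]
        linarith
      · simp only [h, h₁, lt_irrefl, h₁.not_gt, if_true, if_false]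
        linarith
      · simp only [h, h₁, h.not_gt, h₁.not_gt, if_true, if_false]
        linarith
    · by_cases h : K < Real.exp (XT s)
      · simp only [h, h₁, h₁.not_gt, if_true, if_false]
        linarith
      · simp only [h, h₁, h₁.not_gt, if_true, if_false]
        ring
  have hI₁₂ : Integrable (fun s =>
      Real.exp m * (Set.Ioi a).indicator (fun z => Real.exp (σ * z)) ((Z₁ + Z₂) s)
        - K * (Set.Ioi a).indicator (fun z => Real.exp (0 * z)) ((Z₁ + Z₂) s)) P :=
    (hI₁.const_mul _).sub (hI₂.const_mul _)
  have hI₁₂₃ : Integrable (fun s =>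
      Real.exp m * (Set.Ioi a).indicator (fun z => Real.exp (σ * z)) ((Z₁ + Z₂) s)
        - K * (Set.Ioi a).indicator (fun z => Real.exp (0 * z)) ((Z₁ + Z₂) s)
        + K * (Set.Iio b).indicator (fun z => Real.exp (0 * z)) (Z₁ s)) P :=
    hI₁₂.add (hI₃.const_mul _)
  rw [integral_congr_ae hpayoff, integral_sub hI₁₂₃ (hI₄.const_mul _),
    integral_add hI₁₂ (hI₃.const_mul _), integral_sub (hI₁.const_mul _) (hI₂.const_mul _),
    integral_const_mul, integral_const_mul,
    integral_const_mul, integral_const_mul, hE₁, hE₂, hE₃, hE₄,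
    Real.log_div (Real.exp_pos x).ne' hK.ne', Real.log_exp]
  have hs : 0 < Real.sqrt (T - t) := Real.sqrt_pos.mpr hτ
  have hs₁ : 0 < Real.sqrt (T₁ - t) := Real.sqrt_pos.mpr hτ₁
  have hd₁ : (σ * (T - t) - a) / Real.sqrt (T - t)
      = (x - Real.log K + (r + σ ^ 2 / 2) * (T - t)) / (σ * Real.sqrt (T - t)) := by
    rw [ha, hm]; field_simp; ring
  have hd₂ : (0 * (T - t) - a) / Real.sqrt (T - t)
      = (x - Real.log K + (r - σ ^ 2 / 2) * (T - t)) / (σ * Real.sqrt (T - t)) := by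
    rw [ha, hm]; field_simp; ring
  have hd₃ : (b - 0 * (T₁ - t)) / Real.sqrt (T₁ - t)
      = -((x - Real.log K + r * (T - T₁) + (r - σ ^ 2 / 2) * (T₁ - t))
          / (σ * Real.sqrt (T₁ - t))) := by
    rw [hb]; field_simp; ring
  have hd₄ : (b - σ * (T₁ - t)) / Real.sqrt (T₁ - t)
      = -((x - Real.log K + r * (T - T₁) + (r + σ ^ 2 / 2) * (T₁ - t))
          / (σ * Real.sqrt (T₁ - t))) := by
    rw [hb]; field_simp; ring
  rw [hd₁, hd₂, hd₃, hd₄]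
  have hx₁ : Real.exp (-r * (T - t)) * (Real.exp m * Real.exp (σ ^ 2 * (T - t) / 2))
      = Real.exp x := by
    rw [← Real.exp_add, ← Real.exp_add, hm]; congr 1; ring
  have hx₂ : Real.exp (-r * (T - t)) * (Real.exp m *
      (Real.exp (σ ^ 2 * (T₁ - t) / 2) * Real.exp (σ ^ 2 * (T - T₁) / 2))) = Real.exp x := by
    rw [← Real.exp_add, ← Real.exp_add, ← Real.exp_add, hm]; congr 1; ring
  have h0 : ∀ y : ℝ, Real.exp (0 ^ 2 * y / 2) = 1 := fun y => by simp
  rw [h0, h0]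
  generalize stdNormalCDF _ = Φ₁
  generalize stdNormalCDF _ = Φ₂
  generalize stdNormalCDF _ = Φ₃
  generalize stdNormalCDF _ = Φ₄
  linear_combination Φ₁ * hx₁ - Φ₄ * hx₂
end
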